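/- The ε-center Z(A[D]) = {x ∈ A[D] : xy = ε(x̄,ȳ)yx for all homogeneous y ∈ A[D]} of the Γ-graded associative algebra A[D] equals F₁ = A^D = {u ∈ A : ∂(u) = 0 for all ∂ ∈ D}. -/

import Mathlib

/-- A skew-symmetric bicharacter `ε : Γ × Γ → F^×`. -/
def IsBichar {F : Type} [Field F] {Γ : Type} [AddCommGroup Γ] (ε : Γ → Γ → F) : Prop :=
  (∀ lam mu, ε lam mu * ε mu lam = 1) ∧
  (∀ lam mu nu, ε lam (mu + nu) = ε lam mu * ε lam nu)

variable (F : Type) [Field F] (Γ : Type) [AddCommGroup Γ] [DecidableEq Γ]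
  (A : Type) [Ring A] [Algebra F A]

/-- left multiplication operators -/
noncomputable def mulL : A →ₗ[F] Module.End F A := (Algebra.lmul F A).toLinearMap

variable {F Γ A}

/-- `f ∈ End_F(A)` is homogeneous of degree `δ`. -/
def IsHomogMap (𝒜 : Γ → Submodule F A) (δ : Γ) (f : Module.End F A) : Prop :=
  ∀ lam : Γ, ∀ a ∈ 𝒜 lam, f a ∈ 𝒜 (lam + δ)

/-- `f` is a homogeneous color-derivation of degree `δ`. -/
def IsColorDer (𝒜 : Γ → Submodule F A) (ε : Γ → Γ → F) (δ : Γ) (f : Module.End F A) : Prop :=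
  IsHomogMap 𝒜 δ f ∧
  ∀ lam : Γ, ∀ a ∈ 𝒜 lam, ∀ b : A, f (a * b) = f a * b + ε δ lam • (a * f b)

/-- `Der^ε(A)`: the F-span of homogeneous color derivations. -/
def DerE (𝒜 : Γ → Submodule F A) (ε : Γ → Γ → F) : Submodule F (Module.End F A) :=
  Submodule.span F {f | ∃ δ, IsColorDer 𝒜 ε δ f}

/-- `A` is ε-commutative. -/
def IsColorComm (𝒜 : Γ → Submodule F A) (ε : Γ → Γ → F) : Prop :=
  ∀ lam mu : Γ, ∀ a ∈ 𝒜 lam, ∀ b ∈ 𝒜 mu, a * b = ε lam mu • (b * a)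

/-- `D` is color-commutative. -/
def DColorComm (𝒜 : Γ → Submodule F A) (ε : Γ → Γ → F) (D : Submodule F (Module.End F A)) : Prop :=
  ∀ δ δ' f g, f ∈ D → g ∈ D → IsColorDer 𝒜 ε δ f → IsColorDer 𝒜 ε δ' g →
    f * g = ε δ δ' • (g * f)

/-- `D` is a Γ-graded subspace: it is spanned by its homogeneous color-derivations. -/
def DGraded (𝒜 : Γ → Submodule F A) (ε : Γ → Γ → F) (D : Submodule F (Module.End F A)) : Prop :=
  D = Submodule.span F {f | f ∈ D ∧ ∃ δ, IsColorDer 𝒜 ε δ f}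

/-- `A[D]`: the unital subalgebra of `End_F(A)` generated by left multiplications and `D`. -/
noncomputable def AD (D : Submodule F (Module.End F A)) : Subalgebra F (Module.End F A) :=
  Algebra.adjoin F (Set.range (mulL F A) ∪ (D : Set (Module.End F A)))

/-- `A` is Γ-graded `D`-simple. -/
def GradedDSimple (𝒜 : Γ → Submodule F A) [GradedAlgebra 𝒜] (D : Submodule F (Module.End F A)) :
    Prop :=
  ∀ I : Ideal A, Ideal.IsHomogeneous 𝒜 I → (∀ f ∈ D, ∀ x ∈ I, f x ∈ I) → I = ⊥ ∨ I = ⊤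

/-- F₁ = A^D -/
def F1 (D : Submodule F (Module.End F A)) : Submodule F A where
  carrier := {u | ∀ f ∈ D, f u = 0}
  add_mem' := by
    intro a b ha hb f hf
    rw [map_add, ha f hf, hb f hf, add_zero]
  zero_mem' := by intro f hf; exact map_zero f
  smul_mem' := by
    intro c x hx f hf
    rw [map_smul, hx f hf, smul_zero]

/-- the derived space `W = [A[D], A[D]]`. -/
def Wsub (𝒜 : Γ → Submodule F A) (ε : Γ → Γ → F) (D : Submodule F (Module.End F A)) :
    Submodule F (Module.End F A) :=
  Submodule.span F {w | ∃ γ γ' x y, x ∈ AD D ∧ y ∈ AD D ∧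
    IsHomogMap 𝒜 γ x ∧ IsHomogMap 𝒜 γ' y ∧ w = x * y - ε γ γ' • (y * x)}

/-- `F₁[D]`. -/
noncomputable def F1D (D : Submodule F (Module.End F A)) : Subalgebra F (Module.End F A) :=
  Algebra.adjoin F ((mulL F A '' (F1 D : Set A)) ∪ (D : Set (Module.End F A)))

/-- `𝒟 = Der^ε(A) ∩ F₁[D]`. -/
def DScr (𝒜 : Γ → Submodule F A) (ε : Γ → Γ → F) (D : Submodule F (Module.End F A)) :
    Set (Module.End F A) :=
  {f | f ∈ F1D D ∧ f ∈ DerE 𝒜 ε}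

variable {I : Type} [LinearOrder I]

/-- ordered product `d^α`. -/
noncomputable def dpow (d : I → Module.End F A) (α : I →₀ ℕ) : Module.End F A :=
  ((α.support.sort (· ≤ ·)).map fun i => d i ^ α i).prod

/-- membership in the index set 𝒥. -/
def inJ (ε : Γ → Γ → F) (δd : I → Γ) (α : I →₀ ℕ) : Prop :=
  (∀ i, ringChar F ≠ 0 → α i ≤ ringChar F - 1) ∧
  (∀ i, ε (δd i) (δd i) = -1 → α i ≤ 1)

/-- the degree of `d^α`. -/
def degJ (δd : I → Γ) (α : I →₀ ℕ) : Γ := α.sum fun i n => n • δd i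

/-- the subalgebra `S` of `End_F(A)` is Γ-graded simple. -/
def GradedSimpleAlgOn (𝒜 : Γ → Submodule F A) (S : Subalgebra F (Module.End F A)) : Prop :=
  ∀ L : Submodule F (Module.End F A),
    L ≤ Subalgebra.toSubmodule S →
    (∀ x ∈ S, ∀ y ∈ L, x * y ∈ L ∧ y * x ∈ L) →
    L = Submodule.span F {f | f ∈ L ∧ ∃ δ, IsHomogMap 𝒜 δ f} →
    (L = ⊥ ∨ L = Subalgebra.toSubmodule S)

/-- variant of 𝒥 without characteristic restriction -/
def inJ0 (ε : Γ → Γ → F) (δd : I → Γ) (α : I →₀ ℕ) : Prop :=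
  ∀ i, ε (δd i) (δd i) = -1 → α i ≤ 1

/-- the sum `Σ_{α ∈ J0} B d^α` is direct -/
def DirectOn (d : I → Module.End F A) (J0 : Set (I →₀ ℕ)) (Bs : Set A) : Prop :=
  ∀ (s : Finset (I →₀ ℕ)) (c : (I →₀ ℕ) → A), ↑s ⊆ J0 → (∀ α ∈ s, c α ∈ Bs) →
    (∑ α ∈ s, mulL F A (c α) * dpow d α) = 0 → ∀ α ∈ s, mulL F A (c α) * dpow d α = 0

/-- span of color brackets of homogeneous elements of `M` and `N` -/
def brkE (𝒜 : Γ → Submodule F A) (ε : Γ → Γ → F) (M N : Submodule F (Module.End F A)) :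
    Submodule F (Module.End F A) :=
  Submodule.span F {w | ∃ γ γ' x y, x ∈ M ∧ y ∈ N ∧
    IsHomogMap 𝒜 γ x ∧ IsHomogMap 𝒜 γ' y ∧ w = x * y - ε γ γ' • (y * x)}

section ColorCenter

open DirectSum

theorem IsBichar.apply_zero {G : Type} [AddCommGroup G] {ε : G → G → F} (h : IsBichar ε)
    (a : G) : ε a 0 = 1 := by
  have h1 := h.2 a 0 0
  rw [add_zero] at h1
  exact (mul_eq_left₀ (left_ne_zero_of_mul_eq_one (h.1 a 0))).1 h1.symm

theorem IsBichar.zero_apply {G : Type} [AddCommGroup G] {ε : G → G → F} (h : IsBichar ε)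
    (a : G) : ε 0 a = 1 := by
  simpa [h.apply_zero a] using h.1 a 0

theorem IsBichar.add_apply {G : Type} [AddCommGroup G] {ε : G → G → F} (h : IsBichar ε)
    (a b c : G) : ε (a + b) c = ε a c * ε b c := by
  have hne : ε c (a + b) ≠ 0 := left_ne_zero_of_mul_eq_one (h.1 c (a + b))
  apply mul_left_cancel₀ hne
  rw [h.1, h.2]
  linear_combination -(h.1 c a) * ε c b * ε b c - h.1 c b

/-- Linear maps that agree on homogeneous elements are equal. -/
theorem linearMap_ext_homogeneous (𝒜 : Γ → Submodule F A) [GradedAlgebra 𝒜]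
    {f g : Module.End F A} (h : ∀ lam, ∀ a ∈ 𝒜 lam, f a = g a) : f = g := by
  ext x
  induction x using DirectSum.Decomposition.inductionOn 𝒜 with
  | zero => simp
  | homogeneous a => exact h _ a a.2
  | add a b ha hb => rw [map_add, map_add, ha, hb]

/-- A homogeneous map of degree `δ` commutes with projections up to the shift by `δ`. -/
theorem IsHomogMap.apply_decompose {𝒜 : Γ → Submodule F A} [GradedAlgebra 𝒜] {δ : Γ}
    {f : Module.End F A} (hf : IsHomogMap 𝒜 δ f) (x : A) (i : Γ) :
    f (decompose 𝒜 x i : A) = (decompose 𝒜 (f x) (i + δ) : A) := by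
  induction x using DirectSum.Decomposition.inductionOn 𝒜 with
  | zero => simp
  | @homogeneous j a =>
    by_cases hij : j = i
    · subst hij
      rw [decompose_of_mem_same 𝒜 a.2, decompose_of_mem_same 𝒜 (hf _ _ a.2)]
    · rw [decompose_of_mem_ne 𝒜 a.2 hij, map_zero,
        decompose_of_mem_ne 𝒜 (hf _ _ a.2) (fun h => hij (add_right_cancel h))]
  | add a b ha hb => simp [ha, hb]

theorem isHomogMap_mulL {𝒜 : Γ → Submodule F A} [GradedAlgebra 𝒜] {γ : Γ} {u : A}
    (hu : u ∈ 𝒜 γ) : IsHomogMap 𝒜 γ (mulL F A u) := by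
  intro lam a ha
  rw [add_comm]
  exact SetLike.mul_mem_graded hu ha

theorem IsColorDer.map_one {𝒜 : Γ → Submodule F A} [GradedAlgebra 𝒜] {ε : Γ → Γ → F}
    (hε : IsBichar ε) {δ : Γ} {f : Module.End F A} (hf : IsColorDer 𝒜 ε δ f) : f 1 = 0 := by
  have h := hf.2 0 1 SetLike.GradedOne.one_mem 1
  simpa [hε.apply_zero] using h

theorem mem_F1_of_homogeneous {G : Type} [AddCommGroup G] {𝒜 : G → Submodule F A} {ε : G → G → F}
    {D : Submodule F (Module.End F A)} (hDgr : DGraded 𝒜 ε D) {u : A}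
    (h : ∀ δ, ∀ f ∈ D, IsColorDer 𝒜 ε δ f → f u = 0) : u ∈ F1 D := by
  intro f hf
  rw [hDgr] at hf
  induction hf using Submodule.span_induction with
  | mem f hf => obtain ⟨hfD, δ, hδ⟩ := hf; exact h δ f hfD hδ
  | zero => rfl
  | add f g _ _ hf hg => rw [LinearMap.add_apply, hf, hg, add_zero]
  | smul c f _ hf => rw [LinearMap.smul_apply, hf, smul_zero]

/-- The homogeneous components of a `D`-constant are `D`-constants. -/
theorem decompose_mem_F1 {𝒜 : Γ → Submodule F A} [GradedAlgebra 𝒜] {ε : Γ → Γ → F}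
    {D : Submodule F (Module.End F A)} (hDgr : DGraded 𝒜 ε D) {u : A} (hu : u ∈ F1 D) (i : Γ) :
    (decompose 𝒜 u i : A) ∈ F1 D := by
  refine mem_F1_of_homogeneous hDgr fun δ f hf hδ => ?_
  rw [hδ.1.apply_decompose, hu f hf]
  simp

/-- The span of the homogeneous operators that color-commute with multiplication by an element
`u` of degree `γ`. -/
def colorCentralizer (𝒜 : Γ → Submodule F A) (ε : Γ → Γ → F) (γ : Γ) (u : A) :
    Submodule F (Module.End F A) :=
  Submodule.span F {y | ∃ δ, IsHomogMap 𝒜 δ y ∧ ∀ b, y (u * b) = ε δ γ • (u * y b)}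

theorem AD_le_colorCentralizer {𝒜 : Γ → Submodule F A} [GradedAlgebra 𝒜] {ε : Γ → Γ → F}
    (hε : IsBichar ε) (hcomm : IsColorComm 𝒜 ε) {D : Submodule F (Module.End F A)}
    (hDgr : DGraded 𝒜 ε D) {γ : Γ} {u : A} (hu : u ∈ 𝒜 γ) (huD : u ∈ F1 D) :
    Subalgebra.toSubmodule (AD D) ≤ colorCentralizer 𝒜 ε γ u := by
  intro y hy
  rw [Subalgebra.mem_toSubmodule, AD] at hy
  induction hy using Algebra.adjoin_induction with
  | mem y hy =>
    rcases hy with ⟨a, rfl⟩ | hy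
    · induction a using DirectSum.Decomposition.inductionOn 𝒜 with
      | zero => simp
      | @homogeneous i a =>
        refine Submodule.subset_span ⟨i, isHomogMap_mulL a.2, fun b => ?_⟩
        change (a : A) * (u * b) = ε i γ • (u * ((a : A) * b))
        rw [← mul_assoc, hcomm i γ a a.2 u hu, smul_mul_assoc, mul_assoc]
      | add a b ha hb => rw [map_add]; exact add_mem ha hb
    · rw [SetLike.mem_coe, hDgr] at hy
      refine Submodule.span_le.2 ?_ hy
      rintro f ⟨hf, δ, hδ⟩
      refine Submodule.subset_span ⟨δ, hδ.1, fun b => ?_⟩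
      rw [hδ.2 γ u hu, huD f hf, zero_mul, zero_add]
  | algebraMap c =>
    rw [Algebra.algebraMap_eq_smul_one]
    refine Submodule.smul_mem _ _ (Submodule.subset_span ⟨0, fun lam a ha => ?_, fun b => ?_⟩)
    · simpa using ha
    · simp [hε.zero_apply]
  | add x y _ _ hx hy => exact add_mem hx hy
  | mul x y _ _ hx hy =>
    refine (?_ : colorCentralizer 𝒜 ε γ u * colorCentralizer 𝒜 ε γ u ≤ _)
      (Submodule.mul_mem_mul hx hy)
    rw [colorCentralizer, Submodule.span_mul_span, Submodule.span_le]
    rintro _ ⟨x, ⟨δ, hx, hxu⟩, y, ⟨δ', hy, hyu⟩, rfl⟩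
    refine Submodule.subset_span ⟨δ + δ', fun lam a ha => ?_, fun b => ?_⟩
    · rw [add_comm δ δ', ← add_assoc]
      exact hx _ _ (hy _ _ ha)
    · change x (y (u * b)) = ε (δ + δ') γ • (u * x (y b))
      rw [hyu, map_smul, hxu, smul_smul, hε.add_apply, mul_comm]

/-- A homogeneous operator in the color centralizer color-commutes with `u` in its own degree. -/
theorem apply_mul_of_mem_colorCentralizer {𝒜 : Γ → Submodule F A} [GradedAlgebra 𝒜]
    {ε : Γ → Γ → F} {γ : Γ} {u : A} (hu : u ∈ 𝒜 γ) {y : Module.End F A}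
    (hy : y ∈ colorCentralizer 𝒜 ε γ u) {δ : Γ} (hδ : IsHomogMap 𝒜 δ y) {lam : Γ} {a : A}
    (ha : a ∈ 𝒜 lam) : y (u * a) = ε δ γ • (u * y a) := by
  have key : (decompose 𝒜 (y (u * a)) (γ + lam + δ) : A)
      = ε δ γ • (decompose 𝒜 (u * y a) (γ + lam + δ) : A) := by
    clear hδ
    induction hy using Submodule.span_induction with
    | mem y hy =>
      obtain ⟨δ', hy, hyu⟩ := hy
      by_cases h : δ' = δ
      · subst h
        rw [hyu, decompose_smul]
        rfl
      · have hne : γ + lam + δ' ≠ γ + lam + δ := fun h' => h (add_left_cancel h')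
        have hmem : u * y a ∈ 𝒜 (γ + lam + δ') := by
          rw [add_assoc]
          exact SetLike.mul_mem_graded hu (hy _ _ ha)
        rw [decompose_of_mem_ne 𝒜 (hy _ _ (SetLike.mul_mem_graded hu ha)) hne,
          decompose_of_mem_ne 𝒜 hmem hne, smul_zero]
    | zero => simp
    | add x y _ _ hx hy => simp [mul_add, hx, hy]
    | smul c x _ hx =>
      rw [LinearMap.smul_apply, LinearMap.smul_apply, mul_smul_comm, decompose_smul,
        decompose_smul, DirectSum.smul_apply, DirectSum.smul_apply, Submodule.coe_smul,
        Submodule.coe_smul, hx, smul_comm]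
  have hmem : u * y a ∈ 𝒜 (γ + lam + δ) := by
    rw [add_assoc]
    exact SetLike.mul_mem_graded hu (hδ _ _ ha)
  rwa [decompose_of_mem_same 𝒜 (hδ _ _ (SetLike.mul_mem_graded hu ha)),
    decompose_of_mem_same 𝒜 hmem] at key

theorem mulL_mem_AD (D : Submodule F (Module.End F A)) (a : A) : mulL F A a ∈ AD D :=
  Algebra.subset_adjoin (Or.inl ⟨a, rfl⟩)

end ColorCenter

theorem stmt_3
    (𝒜 : Γ → Submodule F A) [GradedAlgebra 𝒜] (ε : Γ → Γ → F)
    (D : Submodule F (Module.End F A))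
    (hchar : (2 : F) ≠ 0)
    (hbich : IsBichar ε)
    (hcomm : IsColorComm 𝒜 ε)
    (hDder : D ≤ DerE 𝒜 ε)
    (hDgr : DGraded 𝒜 ε D)
    (hDcc : DColorComm 𝒜 ε D)
    :
    Submodule.span F {x : Module.End F A | ∃ γ, x ∈ AD D ∧ IsHomogMap 𝒜 γ x ∧
        ∀ γ' y, y ∈ AD D → IsHomogMap 𝒜 γ' y → x * y = ε γ γ' • (y * x)}
      = (F1 D).map (mulL F A) := by
  apply le_antisymm
  · refine Submodule.span_le.2 ?_
    rintro x ⟨γ, -, hx, hxc⟩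
    have hx1 : x 1 ∈ 𝒜 γ := by simpa using hx 0 1 SetLike.GradedOne.one_mem
    refine ⟨x 1, mem_F1_of_homogeneous hDgr fun δ f hf hδ => ?_, ?_⟩
    · have h := LinearMap.congr_fun (hxc δ f (Algebra.subset_adjoin (Or.inr hf)) hδ.1) 1
      simp only [Module.End.mul_apply, LinearMap.smul_apply, hδ.map_one hbich, map_zero] at h
      exact (smul_eq_zero.1 h.symm).resolve_left (left_ne_zero_of_mul_eq_one (hbich.1 γ δ))
    · refine linearMap_ext_homogeneous 𝒜 fun lam a ha => ?_
      have h := LinearMap.congr_fun (hxc lam _ (mulL_mem_AD D a) (isHomogMap_mulL ha)) 1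
      change x (a * 1) = ε γ lam • (a * x 1) at h
      rw [mul_one] at h
      rw [h]
      exact hcomm γ lam (x 1) hx1 a ha
  · classical
    rintro _ ⟨u, hu, rfl⟩
    rw [← DirectSum.sum_support_decompose 𝒜 u, map_sum]
    refine sum_mem fun γ _ => Submodule.subset_span ⟨γ, mulL_mem_AD D _, ?_, ?_⟩
    · exact isHomogMap_mulL (SetLike.coe_mem _)
    · intro γ' y hy hyh
      have huγ := decompose_mem_F1 hDgr hu γ
      have hmem : (DirectSum.decompose 𝒜 u γ : A) ∈ 𝒜 γ := SetLike.coe_mem _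
      refine linearMap_ext_homogeneous 𝒜 fun lam a ha => ?_
      change (DirectSum.decompose 𝒜 u γ : A) * y a
        = ε γ γ' • y ((DirectSum.decompose 𝒜 u γ : A) * a)
      rw [apply_mul_of_mem_colorCentralizer hmem
        (AD_le_colorCentralizer hbich hcomm hDgr hmem huγ hy) hyh ha, smul_smul, hbich.1, one_smul]
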